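/- Let f : ℝⁿ → ℝⁿ, G : ℝⁿ → ℝ^{n×m}, Φ : ℝⁿ → ℝ^{m×p} be continuous, h : ℝⁿ → ℝ continuously differentiable, θ ∈ ℝᵖ, Γ ∈ ℝ^{p×p} symmetric positive definite, and β > 0. Define ψ(x) := (∇h(x)ᵀ G(x) Φ(x))ᵀ and h_a(x, ν, θ̂) := h(x) − ½ (θ − ν)ᵀ Γ⁻¹ (θ − ν) − ½ (ν − θ̂)ᵀ Γ⁻¹ (ν − θ̂). Let T ∈ (0, ∞] and let x : [0, T) → ℝⁿ, ν, θ̂ : [0, T) → ℝᵖ, u : [0, T) → ℝᵐ be such that x, ν, θ̂ are differentiable with x′(t) = f(x(t)) + G(x(t))(u(t) + Φ(x(t)) θ), ν′(t) = −Γ ψ(x(t)), and θ̂′(t) = β Γ (ν(t) − θ̂(t)) for all t ∈ [0, T). Then, writing ν̃(t) := ν(t) − θ̂(t), for all t ∈ [0, T): d/dt [h_a(x(t), ν(t), θ̂(t))] = ∇h(x(t)) ⋅ ( f(x(t)) + G(x(t))(u(t) + Φ(x(t)) θ̂(t)) ) + β ‖ν̃(t)‖² + 2 ν̃(t)ᵀ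 ψ(x(t)). -/

import Mathlib

open Matrix

/-- `ψ(x) := (∇h(x)ᵀ G(x) Φ(x))ᵀ ∈ ℝᵖ`. -/
noncomputable def psi {n m p : ℕ} (h : (Fin n → ℝ) → ℝ)
    (G : (Fin n → ℝ) → Matrix (Fin n) (Fin m) ℝ)
    (Φ : (Fin n → ℝ) → Matrix (Fin m) (Fin p) ℝ)
    (x : Fin n → ℝ) : Fin p → ℝ :=
  fun j => fderiv ℝ h x (fun i => (G x * Φ x) i j)

/-- High-order tuner augmented barrier candidate
`h_a(x, ν, θ̂) := h(x) - ½ (θ - ν)ᵀ Γ⁻¹ (θ - ν) - ½ (ν - θ̂)ᵀ Γ⁻¹ (ν - θ̂)`. -/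
noncomputable def hAhot {n p : ℕ} (h : (Fin n → ℝ) → ℝ) (θ : Fin p → ℝ)
    (Γ : Matrix (Fin p) (Fin p) ℝ) (x : Fin n → ℝ) (ν θhat : Fin p → ℝ) : ℝ :=
  h x - (1 / 2) * ((θ - ν) ⬝ᵥ (Γ⁻¹ *ᵥ (θ - ν)))
      - (1 / 2) * ((ν - θhat) ⬝ᵥ (Γ⁻¹ *ᵥ (ν - θhat)))

theorem LinearMap.apply_mulVec_eq_dotProduct {n p : ℕ} (L : (Fin n → ℝ) →ₗ[ℝ] ℝ)
    (B : Matrix (Fin n) (Fin p) ℝ) (w : Fin p → ℝ) :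
    L (B *ᵥ w) = w ⬝ᵥ fun j => L (fun i => B i j) := by
  rw [mulVec_eq_sum, map_sum]
  simp only [dotProduct, op_smul_eq_smul, map_smul, smul_eq_mul]
  rfl

theorem fderiv_mulVec_mulVec_eq_dotProduct_psi {n m p : ℕ} (h : (Fin n → ℝ) → ℝ)
    (G : (Fin n → ℝ) → Matrix (Fin n) (Fin m) ℝ)
    (Φ : (Fin n → ℝ) → Matrix (Fin m) (Fin p) ℝ) (x : Fin n → ℝ) (w : Fin p → ℝ) :
    fderiv ℝ h x (G x *ᵥ (Φ x *ᵥ w)) = w ⬝ᵥ psi h G Φ x := by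
  rw [mulVec_mulVec]
  exact LinearMap.apply_mulVec_eq_dotProduct (fderiv ℝ h x).toLinearMap _ w

theorem HasDerivAt.dotProduct {ι : Type*} [Fintype ι] {v w : ℝ → ι → ℝ} {v' w' : ι → ℝ}
    {t : ℝ} (hv : HasDerivAt v v' t) (hw : HasDerivAt w w' t) :
    HasDerivAt (fun τ => v τ ⬝ᵥ w τ) (v' ⬝ᵥ w t + v t ⬝ᵥ w') t := by
  simp only [_root_.dotProduct, ← Finset.sum_add_distrib]
  exact HasDerivAt.fun_sum fun i _ => (hasDerivAt_pi.1 hv i).mul (hasDerivAt_pi.1 hw i)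

theorem HasDerivAt.dotProduct_mulVec_self {ι : Type*} [Fintype ι] {A : Matrix ι ι ℝ}
    (hA : A.IsSymm) {v : ℝ → ι → ℝ} {v' : ι → ℝ} {t : ℝ} (hv : HasDerivAt v v' t) :
    HasDerivAt (fun τ => v τ ⬝ᵥ A *ᵥ v τ) (2 * (v t ⬝ᵥ A *ᵥ v')) t := by
  have hAv : HasDerivAt (fun τ => A *ᵥ v τ) (A *ᵥ v') t :=
    A.mulVecLin.toContinuousLinearMap.hasFDerivAt.comp_hasDerivAt t hv
  convert hv.dotProduct hAv using 1
  rw [← dotProduct_transpose_mulVec, hA.eq]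
  ring

/-- high-order tuner derivative identity: along the closed loop with the
high-order tuner `ν' = -Γ ψ(x)`, `θ̂' = β Γ (ν - θ̂)`, and writing `ν̃ := ν - θ̂`,
`d/dt h_a = ∇h ⋅ (f + G(u + Φ θ̂)) + β ‖ν̃‖² + 2 ν̃ᵀ ψ(x)`. -/
theorem stmt_5 {n m p : ℕ}
    (f : (Fin n → ℝ) → (Fin n → ℝ))
    (G : (Fin n → ℝ) → Matrix (Fin n) (Fin m) ℝ)
    (Φ : (Fin n → ℝ) → Matrix (Fin m) (Fin p) ℝ)
    (hf : Continuous f) (hG : Continuous G) (hΦ : Continuous Φ)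
    (h : (Fin n → ℝ) → ℝ) (hh : ContDiff ℝ 1 h)
    (θ : Fin p → ℝ) (Γ : Matrix (Fin p) (Fin p) ℝ) (hΓ : Γ.PosDef)
    (β : ℝ) (hβ : 0 < β)
    (T : EReal) (hT : 0 < T)
    (x : ℝ → Fin n → ℝ) (ν θhat : ℝ → Fin p → ℝ) (u : ℝ → Fin m → ℝ)
    (hx : ∀ t : ℝ, 0 ≤ t → (t : EReal) < T →
      HasDerivAt x (f (x t) + G (x t) *ᵥ (u t + Φ (x t) *ᵥ θ)) t)
    (hν : ∀ t : ℝ, 0 ≤ t → (t : EReal) < T →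
      HasDerivAt ν (-(Γ *ᵥ psi h G Φ (x t))) t)
    (hθhat : ∀ t : ℝ, 0 ≤ t → (t : EReal) < T →
      HasDerivAt θhat (β • (Γ *ᵥ (ν t - θhat t))) t) :
    ∀ t : ℝ, 0 ≤ t → (t : EReal) < T →
      HasDerivAt (fun τ => hAhot h θ Γ (x τ) (ν τ) (θhat τ))
        (fderiv ℝ h (x t) (f (x t) + G (x t) *ᵥ (u t + Φ (x t) *ᵥ θhat t))
          + β * ((ν t - θhat t) ⬝ᵥ (ν t - θhat t))
          + 2 * ((ν t - θhat t) ⬝ᵥ psi h G Φ (x t))) t := by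
  intro t ht htT
  have hΓdet : IsUnit Γ.det := hΓ.det_pos.ne'.isUnit
  have hcancel (w : Fin p → ℝ) : Γ⁻¹ *ᵥ (Γ *ᵥ w) = w := by
    rw [mulVec_mulVec, nonsing_inv_mul _ hΓdet, one_mulVec]
  have hsymm : Γ⁻¹.IsSymm := by
    simpa [IsSymm, IsHermitian, conjTranspose_eq_transpose_of_trivial] using hΓ.inv.isHermitian
  have hh' : HasDerivAt (fun τ => h (x τ)) _ t :=
    ((hh.differentiable one_ne_zero) (x t)).hasFDerivAt.comp_hasDerivAt t (hx t ht htT)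
  have hθν := ((hν t ht htT).const_sub θ).dotProduct_mulVec_self hsymm
  have hνθhat := ((hν t ht htT).sub (hθhat t ht htT)).dotProduct_mulVec_self hsymm
  refine ((hh'.sub (hθν.const_mul (1 / 2))).sub (hνθhat.const_mul (1 / 2))).congr_deriv ?_
  simp only [mulVec_add, map_add, fderiv_mulVec_mulVec_eq_dotProduct_psi, mulVec_sub,
    mulVec_neg, mulVec_smul, hcancel, neg_neg, dotProduct_sub, dotProduct_neg,
    dotProduct_smul, sub_dotProduct, smul_eq_mul, Pi.sub_apply]
  ring
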